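/- The monotone system M^{∇•} is sound and strongly complete with respect to the class of (s)-frames: for every set Γ ∪ {φ} of L(∇,•)-formulas, Γ ⊢_{M^{∇•}} φ if and only if every pointed model (M,s) with M an (s)-model satisfying all members of Γ also satisfies φ. -/

import Mathlib

/-- The language L(∇,•) over propositional variables indexed by ℕ. -/
inductive Formula : Type
  | atom : ℕ → Formula
  | neg : Formula → Formula
  | and : Formula → Formula → Formula
  | nabla : Formula → Formula
  | bullet : Formula → Formula

namespace Formula

/-- Disjunction, defined from ¬ and ∧ as usual. -/
def or (φ ψ : Formula) : Formula := neg ((neg φ).and (neg ψ))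

/-- Implication, defined from ¬ and ∧ as usual. -/
def imp (φ ψ : Formula) : Formula := (neg φ).or ψ

/-- Biimplication, defined from ¬ and ∧ as usual. -/
def biimp (φ ψ : Formula) : Formula := (φ.imp ψ).and (ψ.imp φ)

/-- A fixed tautology ⊤. -/
def top : Formula := (atom 0).imp (atom 0)

/-- Δφ := ¬∇φ. -/
def delta (φ : Formula) : Formula := neg (nabla φ)

/-- ∘φ := ¬•φ. -/
def circ (φ : Formula) : Formula := neg (bullet φ)

end Formula

/-- A neighborhood model. -/
structure NbhdModel : Type 1 where
  S : Type
  ne : Nonempty S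
  N : S → Set (Set S)
  V : ℕ → Set S

namespace NbhdModel

/-- The truth set ⟦φ⟧_M of a formula in a neighborhood model. -/
def truthSet (M : NbhdModel) : Formula → Set M.S
  | .atom p => M.V p
  | .neg φ => (M.truthSet φ)ᶜ
  | .and φ ψ => M.truthSet φ ∩ M.truthSet ψ
  | .nabla φ => {s | M.truthSet φ ∉ M.N s ∧ (M.truthSet φ)ᶜ ∉ M.N s}
  | .bullet φ => {s | s ∈ M.truthSet φ ∧ M.truthSet φ ∉ M.N s}

/-- M,s ⊨ φ. -/
def Sat (M : NbhdModel) (s : M.S) (φ : Formula) : Prop := s ∈ M.truthSet φ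

/-- Property (n): N(s) contains the unit. -/
def PropN (M : NbhdModel) : Prop := ∀ s : M.S, (Set.univ : Set M.S) ∈ M.N s

/-- Property (r): N(s) contains its core. -/
def PropR (M : NbhdModel) : Prop := ∀ s : M.S, ⋂₀ (M.N s) ∈ M.N s

/-- Property (i): N(s) is closed under binary intersections. -/
def PropI (M : NbhdModel) : Prop :=
  ∀ (s : M.S) (X Y : Set M.S), X ∈ M.N s → Y ∈ M.N s → X ∩ Y ∈ M.N s

/-- Property (s): N(s) is supplemented (closed under supersets). -/
def PropS (M : NbhdModel) : Prop :=
  ∀ (s : M.S) (X Y : Set M.S), X ∈ M.N s → X ⊆ Y → Y ∈ M.N s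

/-- Property (c): N(s) is closed under complements. -/
def PropC (M : NbhdModel) : Prop :=
  ∀ (s : M.S) (X : Set M.S), X ∈ M.N s → Xᶜ ∈ M.N s

/-- Property (d). -/
def PropD (M : NbhdModel) : Prop :=
  ∀ (s : M.S) (X : Set M.S), X ∈ M.N s → Xᶜ ∉ M.N s

/-- Property (t). -/
def PropT (M : NbhdModel) : Prop :=
  ∀ (s : M.S) (X : Set M.S), X ∈ M.N s → s ∈ X

/-- Property (b). -/
def PropB (M : NbhdModel) : Prop :=
  ∀ (s : M.S) (X : Set M.S), s ∈ X → {u : M.S | Xᶜ ∉ M.N u} ∈ M.N s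

/-- Property (4). -/
def Prop4 (M : NbhdModel) : Prop :=
  ∀ (s : M.S) (X : Set M.S), X ∈ M.N s → {u : M.S | X ∈ M.N u} ∈ M.N s

/-- Property (5). -/
def Prop5 (M : NbhdModel) : Prop :=
  ∀ (s : M.S) (X : Set M.S), X ∉ M.N s → {u : M.S | X ∉ M.N u} ∈ M.N s

end NbhdModel

/-- φ is an instance of a propositional tautology (treating ∇ψ and •ψ subformulas
as atoms): every Boolean valuation that respects ¬ and ∧ makes φ true. -/
def IsTautology (φ : Formula) : Prop :=
  ∀ v : Formula → Bool,
    (∀ ψ : Formula, v ψ.neg = !v ψ) →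
    (∀ ψ χ : Formula, v (ψ.and χ) = (v ψ && v χ)) →
    v φ = true

/-- Theorems of the system E^{∇•} extended with the extra axioms in `Ax`:
all tautology instances, E1, E2, E3, the members of `Ax`, closed under
modus ponens, RE∇ and RE•. -/
inductive Prf (Ax : Set Formula) : Formula → Prop
  | taut {φ : Formula} : IsTautology φ → Prf Ax φ
  | e1 (φ : Formula) : Prf Ax ((Formula.nabla φ).biimp (Formula.nabla φ.neg))
  | e2 (φ : Formula) : Prf Ax ((Formula.bullet φ).imp φ)
  | e3 (φ : Formula) :
      Prf Ax ((Formula.nabla φ).imp ((Formula.bullet φ).or (Formula.bullet φ.neg)))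
  | ax {φ : Formula} : φ ∈ Ax → Prf Ax φ
  | mp {φ ψ : Formula} : Prf Ax (φ.imp ψ) → Prf Ax φ → Prf Ax ψ
  | reN {φ ψ : Formula} :
      Prf Ax (φ.biimp ψ) → Prf Ax ((Formula.nabla φ).biimp (Formula.nabla ψ))
  | reB {φ ψ : Formula} :
      Prf Ax (φ.biimp ψ) → Prf Ax ((Formula.bullet φ).biimp (Formula.bullet ψ))

/-- Γ ⊢_Λ φ: derivable from theorems of the system together with members of Γ
by modus ponens. -/
inductive Deriv (Ax : Set Formula) (Γ : Set Formula) : Formula → Prop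
  | thm {φ : Formula} : Prf Ax φ → Deriv Ax Γ φ
  | prem {φ : Formula} : φ ∈ Γ → Deriv Ax Γ φ
  | mp {φ ψ : Formula} : Deriv Ax Γ (φ.imp ψ) → Deriv Ax Γ φ → Deriv Ax Γ ψ

/-- No extra axioms: the system E^{∇•}. -/
def EAx : Set Formula := ∅

/-- Extra axiom E4: •φ → ∇φ (all instances); E^{∇•} plus these is E_c^{∇•}. -/
def EcAx : Set Formula := {α | ∃ φ : Formula, α = (Formula.bullet φ).imp (Formula.nabla φ)}

/-- Extra axiom ∘⊤; E^{∇•} plus this is EN^{∇•}. -/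
def ENAx : Set Formula := {Formula.top.bullet.neg}

/-- Extra axioms M1–M4 (all instances); E^{∇•} plus these is M^{∇•}. -/
def MAx : Set Formula :=
  {α | ∃ φ ψ χ : Formula,
      α = ((Formula.nabla (φ.or ψ)).and (Formula.nabla (φ.neg.or χ))).imp (Formula.nabla φ)} ∪
  {α | ∃ φ ψ χ : Formula,
      α = ((Formula.bullet (φ.or ψ)).and (Formula.bullet (φ.neg.or χ))).imp (Formula.nabla φ)} ∪
  {α | ∃ φ ψ χ : Formula,
      α = ((Formula.bullet (φ.or ψ)).and (Formula.nabla (φ.neg.or χ))).imp (Formula.nabla φ)} ∪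
  {α | ∃ φ ψ : Formula,
      α = (φ.circ.and φ).imp ((Formula.delta (φ.or ψ)).and (Formula.circ (φ.or ψ)))}

/-- Extra axioms of R^{∇•}: those of M^{∇•} plus R1 and R2 (all instances). -/
def RAx : Set Formula :=
  MAx ∪
  {α | ∃ φ ψ : Formula,
      α = ((Formula.delta φ).and (Formula.delta ψ)).imp (Formula.delta (φ.and ψ))} ∪
  {α | ∃ φ ψ : Formula,
      α = ((Formula.circ φ).and (Formula.circ ψ)).imp (Formula.circ (φ.and ψ))}

/-- Extra axioms of K^{∇•}: those of R^{∇•} plus ∘⊤. -/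
def KAx : Set Formula := RAx ∪ {Formula.top.bullet.neg}

section Auxiliary

variable {Ax Γ : Set Formula} {φ ψ : Formula}

namespace NbhdModel

variable {M : NbhdModel} {s : M.S}

theorem sat_neg : M.Sat s φ.neg ↔ ¬ M.Sat s φ := Iff.rfl

theorem sat_and : M.Sat s (φ.and ψ) ↔ M.Sat s φ ∧ M.Sat s ψ := Iff.rfl

theorem sat_or : M.Sat s (φ.or ψ) ↔ M.Sat s φ ∨ M.Sat s ψ := by
  simp only [Formula.or, sat_neg, sat_and]; tauto

theorem sat_imp : M.Sat s (φ.imp ψ) ↔ (M.Sat s φ → M.Sat s ψ) := by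
  simp only [Formula.imp, sat_or, sat_neg]; tauto

theorem sat_biimp : M.Sat s (φ.biimp ψ) ↔ (M.Sat s φ ↔ M.Sat s ψ) := by
  simp only [Formula.biimp, sat_imp, sat_and]; tauto

theorem sat_nabla :
    M.Sat s φ.nabla ↔ M.truthSet φ ∉ M.N s ∧ (M.truthSet φ)ᶜ ∉ M.N s := Iff.rfl

theorem sat_bullet : M.Sat s φ.bullet ↔ M.Sat s φ ∧ M.truthSet φ ∉ M.N s := Iff.rfl

theorem truthSet_neg : M.truthSet φ.neg = (M.truthSet φ)ᶜ := rfl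

theorem truthSet_or : M.truthSet (φ.or ψ) = M.truthSet φ ∪ M.truthSet ψ :=
  Set.ext fun _ => sat_or

theorem truthSet_eq_of_biimp (h : ∀ s, M.Sat s (φ.biimp ψ)) : M.truthSet φ = M.truthSet ψ :=
  Set.ext fun s => sat_biimp.1 (h s)

theorem sat_of_isTautology (h : IsTautology φ) : M.Sat s φ := by
  classical
  have hv := h (fun χ => decide (M.Sat s χ)) (fun χ => by simp [sat_neg])
    fun χ ξ => by simp [sat_and]
  simpa using hv

theorem sat_of_mem_MAx (hM : M.PropS) (h : φ ∈ MAx) : M.Sat s φ := by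
  have or_left {α β : Formula} (h : M.truthSet α ∈ M.N s) : M.truthSet (α.or β) ∈ M.N s :=
    hM s _ _ h (truthSet_or ▸ Set.subset_union_left)
  rcases h with ((⟨α, β, γ, rfl⟩ | ⟨α, β, γ, rfl⟩) | ⟨α, β, γ, rfl⟩) | ⟨α, β, rfl⟩
  · rw [sat_imp, sat_and]
    rintro ⟨h₁, h₂⟩
    exact ⟨fun h => h₁.1 (or_left h), fun h => h₂.1 (or_left h)⟩
  · rw [sat_imp, sat_and]
    rintro ⟨h₁, h₂⟩
    exact ⟨fun h => h₁.2 (or_left h), fun h => h₂.2 (or_left h)⟩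
  · rw [sat_imp, sat_and]
    rintro ⟨h₁, h₂⟩
    exact ⟨fun h => h₁.2 (or_left h), fun h => h₂.1 (or_left h)⟩
  · simp only [sat_imp, sat_and, sat_neg, Formula.circ, Formula.delta, sat_bullet, sat_nabla]
    rintro ⟨h₁, h₂⟩
    have h : M.truthSet (α.or β) ∈ M.N s := or_left (by tauto)
    tauto

theorem sat_of_prf (hAx : ∀ α ∈ Ax, ∀ s, M.Sat s α) (h : Prf Ax φ) (s : M.S) : M.Sat s φ := by
  induction h generalizing s with
  | taut h => exact sat_of_isTautology h
  | e1 α =>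
    rw [sat_biimp, sat_nabla, sat_nabla, truthSet_neg, compl_compl, and_comm]
  | e2 α => exact sat_imp.2 And.left
  | e3 α =>
    rw [sat_imp, sat_or, sat_bullet, sat_bullet, sat_nabla, truthSet_neg, sat_neg]
    tauto
  | ax h => exact hAx _ h s
  | mp _ _ ih₁ ih₂ => exact sat_imp.1 (ih₁ s) (ih₂ s)
  | reN _ ih => rw [sat_biimp, sat_nabla, sat_nabla, truthSet_eq_of_biimp ih]
  | reB _ ih =>
    rw [sat_biimp, sat_bullet, sat_bullet, truthSet_eq_of_biimp ih, sat_biimp.1 (ih s)]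

theorem sat_of_deriv (hAx : ∀ α ∈ Ax, ∀ s, M.Sat s α) (hΓ : ∀ γ ∈ Γ, M.Sat s γ)
    (h : Deriv Ax Γ φ) : M.Sat s φ := by
  induction h with
  | thm h => exact sat_of_prf hAx h s
  | prem h => exact hΓ _ h
  | mp _ _ ih₁ ih₂ => exact sat_imp.1 ih₁ ih₂

end NbhdModel

namespace Deriv

theorem taut (h : IsTautology φ) : Deriv Ax Γ φ := .thm (.taut h)

theorem deduction (h : Deriv Ax (insert φ Γ) ψ) : Deriv Ax Γ (φ.imp ψ) := by
  have weaken {α : Formula} (h : Deriv Ax Γ α) : Deriv Ax Γ (φ.imp α) := by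
    refine .mp (taut fun v hn ha => ?_) h
    simp only [Formula.imp, Formula.or, hn, ha]
    cases v φ <;> cases v α <;> rfl
  induction h with
  | thm h => exact weaken (.thm h)
  | @prem α h =>
    rcases h with rfl | h
    · refine taut fun v hn ha => ?_
      simp only [Formula.imp, Formula.or, hn, ha]
      cases v α <;> rfl
    · exact weaken (.prem h)
  | @mp α β _ _ ih₁ ih₂ =>
    refine .mp (.mp (taut fun v hn ha => ?_) ih₁) ih₂
    simp only [Formula.imp, Formula.or, hn, ha]
    cases v φ <;> cases v α <;> cases v β <;> rfl

theorem prf (h : Deriv Ax ∅ φ) : Prf Ax φ := by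
  induction h with
  | thm h => exact h
  | prem h => exact h.elim
  | mp _ _ ih₁ ih₂ => exact .mp ih₁ ih₂

theorem mono {Γ' : Set Formula} (hΓ : Γ ⊆ Γ') (h : Deriv Ax Γ φ) : Deriv Ax Γ' φ := by
  induction h with
  | thm h => exact .thm h
  | prem h => exact .prem (hΓ h)
  | mp _ _ ih₁ ih₂ => exact .mp ih₁ ih₂

theorem exists_of_sUnion {c : Set (Set Formula)} (hc : IsChain (· ⊆ ·) c) (hne : c.Nonempty)
    (h : Deriv Ax (⋃₀ c) φ) : ∃ Γ ∈ c, Deriv Ax Γ φ := by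
  induction h with
  | thm h => exact hne.imp fun _ hΓ => ⟨hΓ, .thm h⟩
  | prem h =>
    obtain ⟨Γ, hΓ, h⟩ := h
    exact ⟨Γ, hΓ, .prem h⟩
  | mp _ _ ih₁ ih₂ =>
    obtain ⟨Γ₁, hΓ₁, h₁⟩ := ih₁
    obtain ⟨Γ₂, hΓ₂, h₂⟩ := ih₂
    rcases hc.total hΓ₁ hΓ₂ with h | h
    · exact ⟨Γ₂, hΓ₂, .mp (h₁.mono h) h₂⟩
    · exact ⟨Γ₁, hΓ₁, .mp h₁ (h₂.mono h)⟩

end Deriv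

/-- Maximal consistent sets of the system with extra axioms `Ax`. -/
structure MaxCons (Ax : Set Formula) where
  carrier : Set Formula
  mem_of_deriv : ∀ {φ : Formula}, Deriv Ax carrier φ → φ ∈ carrier
  mem_neg : ∀ {φ : Formula}, φ.neg ∈ carrier ↔ φ ∉ carrier

namespace MaxCons

variable {w : MaxCons Ax}

theorem mem_of_prf (h : Prf Ax φ) : φ ∈ w.carrier := w.mem_of_deriv (.thm h)

theorem mem_and : φ.and ψ ∈ w.carrier ↔ φ ∈ w.carrier ∧ ψ ∈ w.carrier := by
  have elim {α β : Formula} (ht : IsTautology (α.imp β)) (h : α ∈ w.carrier) : β ∈ w.carrier :=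
    w.mem_of_deriv (.mp (.taut ht) (.prem h))
  refine ⟨fun h => ⟨elim (fun v hn ha => ?_) h, elim (fun v hn ha => ?_) h⟩,
    fun ⟨h₁, h₂⟩ => w.mem_of_deriv (.mp (.mp (.taut fun v hn ha => ?_) (.prem h₁)) (.prem h₂))⟩
  all_goals
    simp only [Formula.imp, Formula.or, hn, ha]
    cases v φ <;> cases v ψ <;> rfl

theorem mem_or : φ.or ψ ∈ w.carrier ↔ φ ∈ w.carrier ∨ ψ ∈ w.carrier := by
  simp only [Formula.or, mem_neg, mem_and]; tauto

theorem mem_imp : φ.imp ψ ∈ w.carrier ↔ (φ ∈ w.carrier → ψ ∈ w.carrier) := by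
  simp only [Formula.imp, mem_or, mem_neg]; tauto

theorem mem_biimp : φ.biimp ψ ∈ w.carrier ↔ (φ ∈ w.carrier ↔ ψ ∈ w.carrier) := by
  simp only [Formula.biimp, mem_imp, mem_and]; tauto

/-- Lindenbaum's lemma. -/
theorem exists_of_not_deriv (h : ¬ Deriv Ax Γ φ) :
    ∃ w : MaxCons Ax, Γ ⊆ w.carrier ∧ φ ∉ w.carrier := by
  obtain ⟨Δ, hΓΔ, hΔ⟩ := zorn_subset_nonempty {Δ | ¬ Deriv Ax Δ φ}
    (fun c hcS hc hne => ⟨⋃₀ c, fun hd =>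
      let ⟨_, hΔc, hΔ⟩ := Deriv.exists_of_sUnion hc hne hd
      hcS hΔc hΔ, fun _ => Set.subset_sUnion_of_mem⟩) Γ h
  have deriv_imp {α : Formula} (hα : α ∉ Δ) : Deriv Ax Δ (α.imp φ) := by
    by_contra hd
    exact hα (hΔ.le_of_ge (y := insert α Δ) (fun hi => hd hi.deduction)
      (Set.subset_insert α Δ) (Set.mem_insert α Δ))
  refine ⟨⟨Δ, fun {α} hα => ?_, fun {α} => ⟨fun hn hα => ?_, fun hα => ?_⟩⟩, hΓΔ,
    fun hφ => hΔ.prop (.prem hφ)⟩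
  · by_contra hmem
    exact hΔ.prop (.mp (deriv_imp hmem) hα)
  · refine hΔ.prop (.mp (.mp (.taut fun v hvn hva => ?_) (.prem hn)) (.prem hα))
    simp only [Formula.imp, Formula.or, hvn, hva]
    cases v φ <;> cases v α <;> rfl
  · by_contra hn
    refine hΔ.prop (.mp (.mp (.taut fun v hvn hva => ?_) (deriv_imp hα)) (deriv_imp hn))
    simp only [Formula.imp, Formula.or, hvn, hva]
    cases v φ <;> cases v α <;> rfl

theorem prf_of_forall_mem (h : ∀ w : MaxCons Ax, φ ∈ w.carrier) : Prf Ax φ := by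
  by_contra hφ
  obtain ⟨w, -, hw⟩ := exists_of_not_deriv (Γ := ∅) fun hd => hφ (Deriv.prf hd)
  exact hw (h w)

theorem mem_nabla_congr (h : ∀ w : MaxCons Ax, φ ∈ w.carrier ↔ ψ ∈ w.carrier) :
    φ.nabla ∈ w.carrier ↔ ψ.nabla ∈ w.carrier :=
  mem_biimp.1 (mem_of_prf (.reN (prf_of_forall_mem fun w => mem_biimp.2 (h w))))

theorem mem_bullet_congr (h : ∀ w : MaxCons Ax, φ ∈ w.carrier ↔ ψ ∈ w.carrier) :
    φ.bullet ∈ w.carrier ↔ ψ.bullet ∈ w.carrier :=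
  mem_biimp.1 (mem_of_prf (.reB (prf_of_forall_mem fun w => mem_biimp.2 (h w))))

theorem mem_nabla_neg : φ.neg.nabla ∈ w.carrier ↔ φ.nabla ∈ w.carrier :=
  (mem_biimp.1 (mem_of_prf (.e1 φ))).symm

theorem mem_of_mem_bullet (h : φ.bullet ∈ w.carrier) : φ ∈ w.carrier :=
  mem_imp.1 (mem_of_prf (.e2 φ)) h

theorem mem_bullet_neg_neg : φ.neg.neg.bullet ∈ w.carrier ↔ φ.bullet ∈ w.carrier :=
  mem_bullet_congr fun w => by simp only [mem_neg, not_not]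

/-- The formulas whose truth sets are forced to be neighborhoods of `w`. -/
def Necessitated (w : MaxCons Ax) (φ : Formula) : Prop :=
  (φ ∈ w.carrier ∧ φ.bullet ∉ w.carrier) ∨ (φ.nabla ∉ w.carrier ∧ φ.neg.bullet ∈ w.carrier)

theorem necessitated_or_neg (h : φ.nabla ∉ w.carrier) :
    w.Necessitated φ ∨ w.Necessitated φ.neg := by
  simp only [Necessitated, mem_nabla_neg, mem_bullet_neg_neg, mem_neg]
  tauto

theorem not_mem_of_necessitated_of_le {w : MaxCons MAx} (h : w.Necessitated ψ)
    (hle : ∀ v : MaxCons MAx, ψ ∈ v.carrier → φ ∈ v.carrier) :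
    φ.nabla ∉ w.carrier ∧ φ.bullet ∉ w.carrier := by
  have hor (v : MaxCons MAx) : ψ.or φ ∈ v.carrier ↔ φ ∈ v.carrier := by
    rw [mem_or]
    exact or_iff_right_of_imp (hle v)
  have hself (v : MaxCons MAx) : ψ.neg.or ψ.neg ∈ v.carrier ↔ ψ.neg ∈ v.carrier := by
    rw [mem_or, or_self]
  rcases h with ⟨hψ, hb⟩ | ⟨hn, hb⟩
  · have h := mem_imp.1 (mem_of_prf (w := w) (.ax (Or.inr ⟨ψ, φ, rfl⟩)))
    simp only [mem_and, Formula.circ, Formula.delta, mem_neg] at h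
    rw [← mem_nabla_congr hor, ← mem_bullet_congr hor]
    exact h ⟨hb, hψ⟩
  · constructor
    · intro hφ
      have hdneg (v : MaxCons MAx) : ψ.neg.neg.or φ ∈ v.carrier ↔ φ ∈ v.carrier := by
        rw [← hor, mem_or, mem_or, mem_neg, mem_neg, not_not]
      have h := mem_imp.1 (mem_of_prf (w := w) (.ax (Or.inl (Or.inr ⟨ψ.neg, ψ.neg, φ, rfl⟩))))
      rw [mem_and, mem_bullet_congr hself, mem_nabla_congr hdneg, mem_nabla_neg] at h
      exact hn (h ⟨hb, hφ⟩)
    · intro hφ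
      have h := mem_imp.1
        (mem_of_prf (w := w) (.ax (Or.inl (Or.inl (Or.inr ⟨ψ, φ, ψ.neg, rfl⟩)))))
      rw [mem_and, mem_bullet_congr hor, mem_bullet_congr hself] at h
      exact hn (h ⟨hφ, hb⟩)

end MaxCons

/-- The canonical supplemented model of M^{∇•}, based at a given maximal consistent set. -/
def canonicalModel (w₀ : MaxCons MAx) : NbhdModel where
  S := MaxCons MAx
  ne := ⟨w₀⟩
  N w := {X | ∃ φ, w.Necessitated φ ∧ {v : MaxCons MAx | φ ∈ v.carrier} ⊆ X}
  V p := {w | .atom p ∈ w.carrier}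

theorem canonicalModel_propS (w₀ : MaxCons MAx) : (canonicalModel w₀).PropS :=
  fun _ _ _ ⟨φ, hφ, hX⟩ hXY => ⟨φ, hφ, hX.trans hXY⟩

theorem truthSet_canonicalModel (w₀ : MaxCons MAx) (φ : Formula) :
    (canonicalModel w₀).truthSet φ = {w : MaxCons MAx | φ ∈ w.carrier} := by
  induction φ with
  | atom p => rfl
  | neg φ ih =>
    ext w
    simp only [NbhdModel.truthSet, ih]
    exact w.mem_neg.symm
  | and φ ψ ih₁ ih₂ =>
    ext w
    simp only [NbhdModel.truthSet, ih₁, ih₂]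
    exact MaxCons.mem_and.symm
  | nabla φ ih =>
    ext w
    simp only [NbhdModel.truthSet, ih]
    constructor
    · rintro ⟨h₁, h₂⟩
      by_contra hn
      rcases MaxCons.necessitated_or_neg hn with h | h
      · exact h₁ ⟨φ, h, subset_rfl⟩
      · exact h₂ ⟨φ.neg, h, fun v hv => v.mem_neg.1 hv⟩
    · intro h
      refine ⟨fun ⟨ψ, hψ, hle⟩ => ?_, fun ⟨ψ, hψ, hle⟩ => ?_⟩
      · exact (MaxCons.not_mem_of_necessitated_of_le hψ fun _ hv => hle hv).1 h
      · exact (MaxCons.not_mem_of_necessitated_of_le (φ := φ.neg) hψ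
          fun v hv => v.mem_neg.2 (hle hv)).1 (MaxCons.mem_nabla_neg.2 h)
  | bullet φ ih =>
    ext w
    simp only [NbhdModel.truthSet, ih]
    constructor
    · rintro ⟨h₁, h₂⟩
      by_contra hb
      exact h₂ ⟨φ, Or.inl ⟨h₁, hb⟩, subset_rfl⟩
    · intro h
      exact ⟨MaxCons.mem_of_mem_bullet h, fun ⟨ψ, hψ, hle⟩ =>
        (MaxCons.not_mem_of_necessitated_of_le hψ fun _ hv => hle hv).2 h⟩

end Auxiliary

/-- M^{∇•} is sound and strongly complete with respect to the
class of (s)-frames. -/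
theorem M_sound_and_strongly_complete (Γ : Set Formula) (φ : Formula) :
    Deriv MAx Γ φ ↔
      ∀ (M : NbhdModel), M.PropS →
        ∀ s : M.S, (∀ γ ∈ Γ, M.Sat s γ) → M.Sat s φ := by
  refine ⟨fun h M hM s hΓ => NbhdModel.sat_of_deriv
    (fun _ hα _ => NbhdModel.sat_of_mem_MAx hM hα) hΓ h, fun h => ?_⟩
  by_contra hd
  obtain ⟨w, hΓ, hφ⟩ := MaxCons.exists_of_not_deriv hd
  have hsat (α : Formula) : (canonicalModel w).Sat w α ↔ α ∈ w.carrier :=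
    iff_of_eq (congrArg (w ∈ ·) (truthSet_canonicalModel w α))
  exact hφ ((hsat φ).1 (h _ (canonicalModel_propS w) w fun γ hγ => (hsat γ).2 (hΓ hγ)))
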